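/- The algebra C_{22} of invariants of two generic 2×2 matrices is a polynomial algebra: the five elements tr(x_1), tr(x_2), det(x_1), det(x_2), tr(x_1 x_2) of Ω = K[x_{pq}^{(i)} : 1 ≤ p,q ≤ 2, i = 1,2] are algebraically independent over K and generate C_{22}, so C_{22} is isomorphic as a K-algebra to the polynomial algebra in five variables K[a_1, a_2, b_1, b_2, c]. -/

import Mathlib

open Matrix

variable (K : Type*) [Field K] [IsAlgClosed K] [CharZero K]

/-- The `i`-th generic `2 × 2` matrix (`i = 0, 1`): the matrix over the polynomial algebra
`Ω = K[x_{pq}^{(i)}]` in `8` variables whose `(p,q)`-entry is the variable `x_{pq}^{(i)}`. -/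
noncomputable def genericMatrix (i : Fin 2) :
    Matrix (Fin 2) (Fin 2) (MvPolynomial (Fin 2 × Fin 2 × Fin 2) K) :=
  Matrix.of fun p q => MvPolynomial.X (i, p, q)

/-- The algebra `C_{22}` of invariants of two generic `2 × 2` matrices: the subalgebra of `Ω`
generated by the traces of all products of the generic matrices. -/
noncomputable def matrixInvariants22 :
    Subalgebra K (MvPolynomial (Fin 2 × Fin 2 × Fin 2) K) :=
  Algebra.adjoin K
    {x | ∃ l : List (Fin 2), l ≠ [] ∧ x = Matrix.trace ((l.map (genericMatrix K)).prod)}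

open MvPolynomial in
/-- Every point of `K⁵` is the vector of invariants of some pair of `2 × 2` matrices. -/
lemma exists_eval_invariants_eq (K : Type*) [Field K] [IsAlgClosed K] (w : Fin 5 → K) :
    ∃ e : Fin 2 × Fin 2 × Fin 2 → K, ∀ j,
      eval e (![Matrix.trace (genericMatrix K 0), Matrix.trace (genericMatrix K 1),
        Matrix.det (genericMatrix K 0), Matrix.det (genericMatrix K 1),
        Matrix.trace (genericMatrix K 0 * genericMatrix K 1)] j) = w j := by
  obtain ⟨v, hv⟩ : ∃ v : K, v * v - w 1 * v + w 3 = 0 := by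
    obtain ⟨v, hv⟩ := IsAlgClosed.exists_root
      (Polynomial.C 1 * Polynomial.X ^ 2 + Polynomial.C (-w 1) * Polynomial.X +
        Polynomial.C (w 3)) (by rw [Polynomial.degree_quadratic one_ne_zero]; decide)
    refine ⟨v, ?_⟩
    simp only [Polynomial.IsRoot.def, Polynomial.eval_add, Polynomial.eval_mul,
      Polynomial.eval_pow, Polynomial.eval_C, Polynomial.eval_X] at hv
    linear_combination hv
  refine ⟨fun i => (![!![0, -w 2; 1, w 0], !![w 1 - v, w 4 - w 0 * v; 0, v]] i.1) i.2.1 i.2.2,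
    fun j => ?_⟩
  fin_cases j <;>
    simp [genericMatrix, Matrix.trace_fin_two, Matrix.det_fin_two, Matrix.mul_apply]
  linear_combination -hv

/-- The five basic invariants are algebraically independent. -/
lemma algebraicIndependent_invariants (K : Type*) [Field K] [IsAlgClosed K] :
    AlgebraicIndependent K
      ![Matrix.trace (genericMatrix K 0), Matrix.trace (genericMatrix K 1),
        Matrix.det (genericMatrix K 0), Matrix.det (genericMatrix K 1),
        Matrix.trace (genericMatrix K 0 * genericMatrix K 1)] := by
  rw [algebraicIndependent_iff]
  intro p hp
  have : Infinite K := IsAlgClosed.instInfinite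
  refine MvPolynomial.funext fun w => ?_
  obtain ⟨e, he⟩ := exists_eval_invariants_eq K w
  have h := congrArg (MvPolynomial.eval e) hp
  rw [MvPolynomial.aeval_def, MvPolynomial.eval_eval₂, map_zero] at h
  rw [map_zero, ← h, MvPolynomial.eval, MvPolynomial.coe_eval₂Hom]
  congr 1
  · ext; simp
  · exact (funext he).symm

/-- A subalgebra containing the five basic invariants of a pair of `2 × 2` matrices `x 0`, `x 1`
contains the coefficients of every word in `x 0`, `x 1` with respect to
`1`, `x 0`, `x 1`, `x 0 * x 1`. -/
lemma exists_list_prod_eq {K R : Type*} [CommRing K] [CommRing R] [Algebra K R]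
    (x : Fin 2 → Matrix (Fin 2) (Fin 2) R) (A : Subalgebra K R)
    (ht₀ : (x 0).trace ∈ A) (ht₁ : (x 1).trace ∈ A) (hd₀ : (x 0).det ∈ A) (hd₁ : (x 1).det ∈ A)
    (ht : (x 0 * x 1).trace ∈ A) (l : List (Fin 2)) :
    ∃ p ∈ A, ∃ q ∈ A, ∃ r ∈ A, ∃ s ∈ A,
      (l.map x).prod = p • 1 + q • x 0 + r • x 1 + s • (x 0 * x 1) := by
  induction l with
  | nil => exact ⟨1, A.one_mem, 0, A.zero_mem, 0, A.zero_mem, 0, A.zero_mem, by simp⟩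
  | cons i l ih =>
    obtain ⟨p, hp, q, hq, r, hr, s, hs, h⟩ := ih
    rw [List.map_cons, List.prod_cons, h]
    have sq (y : Matrix (Fin 2) (Fin 2) R) : y * y = y.trace • y - y.det • 1 := by
      ext i j
      fin_cases i <;> fin_cases j <;>
        simp [Matrix.trace_fin_two, Matrix.det_fin_two, Matrix.mul_apply] <;> ring
    have swap : x 1 * x 0 = (x 1).trace • x 0 + (x 0).trace • x 1 - x 0 * x 1 +
        ((x 0 * x 1).trace - (x 0).trace * (x 1).trace) • 1 := by
      ext i j
      fin_cases i <;> fin_cases j <;>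
        simp [Matrix.trace_fin_two, Matrix.mul_apply] <;> ring
    have swap_mul : x 1 * (x 0 * x 1) = (x 1).det • x 0 - ((x 0).trace * (x 1).det) • 1 +
        (x 0 * x 1).trace • x 1 := by
      rw [← mul_assoc, swap]
      simp only [add_mul, sub_mul, smul_mul_assoc, mul_assoc, sq (x 1), mul_sub, mul_smul_comm,
        one_mul, mul_one]
      module
    fin_cases i
    · refine ⟨-(q * (x 0).det), by aesop, p + q * (x 0).trace, by aesop,
        -(s * (x 0).det), by aesop, r + s * (x 0).trace, by aesop, ?_⟩
      simp only [Fin.zero_eta, mul_add, mul_smul_comm, mul_one, ← mul_assoc, sq (x 0), sub_mul,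
        smul_mul_assoc, one_mul]
      module
    · refine ⟨q * ((x 0 * x 1).trace - (x 0).trace * (x 1).trace) - r * (x 1).det
          - s * ((x 0).trace * (x 1).det), ?_, q * (x 1).trace + s * (x 1).det, ?_,
        p + q * (x 0).trace + r * (x 1).trace + s * (x 0 * x 1).trace, ?_, -q, ?_, ?_⟩
      · exact sub_mem (sub_mem (mul_mem hq (sub_mem ht (mul_mem ht₀ ht₁))) (mul_mem hr hd₁))
          (mul_mem hs (mul_mem ht₀ hd₁))
      · exact add_mem (mul_mem hq ht₁) (mul_mem hs hd₁)
      · exact add_mem (add_mem (add_mem hp (mul_mem hq ht₀)) (mul_mem hr ht₁)) (mul_mem hs ht)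
      · exact neg_mem hq
      · simp only [Fin.mk_one, mul_add, mul_smul_comm, mul_one, swap_mul, swap, sq (x 1)]
        module

/-- The five basic invariants generate `C_{22}`. -/
lemma adjoin_invariants_eq (K : Type*) [Field K] [CharZero K] :
    Algebra.adjoin K
      {Matrix.trace (genericMatrix K 0), Matrix.trace (genericMatrix K 1),
        Matrix.det (genericMatrix K 0), Matrix.det (genericMatrix K 1),
        Matrix.trace (genericMatrix K 0 * genericMatrix K 1)} = matrixInvariants22 K := by
  apply le_antisymm
  · have word (l : List (Fin 2)) (hl : l ≠ []) :
        Matrix.trace ((l.map (genericMatrix K)).prod) ∈ matrixInvariants22 K :=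
      Algebra.subset_adjoin ⟨l, hl, rfl⟩
    have tr (i : Fin 2) : Matrix.trace (genericMatrix K i) ∈ matrixInvariants22 K := by
      simpa using word [i] (by simp)
    have tr_mul (i j : Fin 2) :
        Matrix.trace (genericMatrix K i * genericMatrix K j) ∈ matrixInvariants22 K := by
      simpa using word [i, j] (by simp)
    have det (i : Fin 2) : Matrix.det (genericMatrix K i) ∈ matrixInvariants22 K := by
      have h : Matrix.det (genericMatrix K i) = (2⁻¹ : K) •
          (Matrix.trace (genericMatrix K i) * Matrix.trace (genericMatrix K i) -
            Matrix.trace (genericMatrix K i * genericMatrix K i)) := by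
        rw [eq_inv_smul_iff₀ two_ne_zero, two_smul]
        simp only [Matrix.trace_fin_two, Matrix.det_fin_two, Matrix.mul_apply, Fin.sum_univ_two]
        ring
      rw [h]
      exact Subalgebra.smul_mem _ (sub_mem (mul_mem (tr i) (tr i)) (tr_mul i i)) _
    rw [Algebra.adjoin_le_iff]
    rintro _ (rfl | rfl | rfl | rfl | rfl)
    exacts [tr 0, tr 1, det 0, det 1, tr_mul 0 1]
  · refine Algebra.adjoin_le ?_
    rintro _ ⟨l, -, rfl⟩
    set A := Algebra.adjoin K
      {Matrix.trace (genericMatrix K 0), Matrix.trace (genericMatrix K 1),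
        Matrix.det (genericMatrix K 0), Matrix.det (genericMatrix K 1),
        Matrix.trace (genericMatrix K 0 * genericMatrix K 1)}
    have ht₀ : Matrix.trace (genericMatrix K 0) ∈ A := Algebra.subset_adjoin (by simp)
    have ht₁ : Matrix.trace (genericMatrix K 1) ∈ A := Algebra.subset_adjoin (by simp)
    have ht : Matrix.trace (genericMatrix K 0 * genericMatrix K 1) ∈ A :=
      Algebra.subset_adjoin (by simp)
    obtain ⟨p, hp, q, hq, r, hr, s, hs, h⟩ := exists_list_prod_eq (genericMatrix K) A ht₀ ht₁
      (Algebra.subset_adjoin (by simp)) (Algebra.subset_adjoin (by simp)) ht l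
    rw [h]
    simp only [Matrix.trace_add, Matrix.trace_smul, smul_eq_mul, Matrix.trace_one,
      Fintype.card_fin]
    exact add_mem (add_mem (add_mem (mul_mem hp (natCast_mem A 2)) (mul_mem hq ht₀))
      (mul_mem hr ht₁)) (mul_mem hs ht)

/-- **Sibirskii.** `C_{22}` is a polynomial algebra: the five invariants `tr(x_1)`, `tr(x_2)`,
`det(x_1)`, `det(x_2)`, `tr(x_1 x_2)` are algebraically independent over `K` and generate
`C_{22}`, so `C_{22}` is isomorphic to the polynomial algebra in five variables. -/
theorem matrixInvariants22_polynomial :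
    AlgebraicIndependent K
      ![Matrix.trace (genericMatrix K 0), Matrix.trace (genericMatrix K 1),
        Matrix.det (genericMatrix K 0), Matrix.det (genericMatrix K 1),
        Matrix.trace (genericMatrix K 0 * genericMatrix K 1)] ∧
    Algebra.adjoin K
      {Matrix.trace (genericMatrix K 0), Matrix.trace (genericMatrix K 1),
        Matrix.det (genericMatrix K 0), Matrix.det (genericMatrix K 1),
        Matrix.trace (genericMatrix K 0 * genericMatrix K 1)} = matrixInvariants22 K ∧
    Nonempty ((matrixInvariants22 K) ≃ₐ[K] MvPolynomial (Fin 5) K) := by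
  have hind := algebraicIndependent_invariants K
  have hgen := adjoin_invariants_eq K
  refine ⟨hind, hgen, ⟨(hind.aevalEquiv.trans (Subalgebra.equivOfEq _ _ ?_)).symm⟩⟩
  rw [← hgen]
  congr 1
  simp only [Matrix.range_cons, Matrix.range_empty, Set.union_empty, Set.singleton_union]
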